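/- For every integer n ≥ 1 and real J > 0, the effective Hamiltonian H_eff = (J/(2n)) ∑_{1≤i<j≤n} ∑_{α,β∈{x,y,z}} (σ_{iL}^α σ_{jL}^β − σ_{iR}^α σ_{jR}^β)² satisfies the operator identity H_eff = −(J/(2n)) (∑_{i=1}^n σ⃗_{iL}·σ⃗_{iR})² + (9J/2)(n−1)·Id + (J/(2n)) ∑_{i=1}^n (σ⃗_{iL}·σ⃗_{iR})², where σ⃗_{iL}·σ⃗_{iR} := ∑_{α∈{x,y,z}} σ_{iL}^α σ_{iR}^α. -/

import Mathlib

open scoped BigOperators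

/-- The Pauli matrices `σ^x, σ^y, σ^z`, indexed by `Fin 3`. -/
noncomputable def pauli : Fin 3 → Matrix (Fin 2) (Fin 2) ℂ
  | 0 => !![0, 1; 1, 0]
  | 1 => !![0, -Complex.I; Complex.I, 0]
  | 2 => !![1, 0; 0, -1]

/-- The Hilbert space of `2n` qubits labelled `(i,a)` with `i : Fin n` and `a : Bool`
(`a = false` is the `L` replica, `a = true` is the `R` replica) is `(ℂ²)^{⊗2n}`, whose
computational basis is indexed by `(Fin n × Bool) → Fin 2`.  `siteOp n q M` is the
single-site operator acting as `M` on qubit `q` and as the identity elsewhere. -/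
noncomputable def siteOp (n : ℕ) (q : Fin n × Bool) (M : Matrix (Fin 2) (Fin 2) ℂ) :
    Matrix ((Fin n × Bool) → Fin 2) ((Fin n × Bool) → Fin 2) ℂ :=
  Matrix.of fun x y =>
    (if ∀ p : Fin n × Bool, p ≠ q → x p = y p then (1 : ℂ) else 0) * M (x q) (y q)

/-- The Heisenberg coupling `σ⃗_{iL}·σ⃗_{iR} = ∑_{α∈{x,y,z}} σ_{iL}^α σ_{iR}^α`. -/
noncomputable def heis (n : ℕ) (i : Fin n) :
    Matrix ((Fin n × Bool) → Fin 2) ((Fin n × Bool) → Fin 2) ℂ :=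
  ∑ α : Fin 3, siteOp n (i, false) (pauli α) * siteOp n (i, true) (pauli α)

/-- The effective Hamiltonian
`H_eff = (J/(2n)) ∑_{i<j} ∑_{α,β} (σ_{iL}^α σ_{jL}^β − σ_{iR}^α σ_{jR}^β)²`. -/
noncomputable def Heff (n : ℕ) (J : ℝ) :
    Matrix ((Fin n × Bool) → Fin 2) ((Fin n × Bool) → Fin 2) ℂ :=
  ((J / (2 * n) : ℝ) : ℂ) •
    ∑ i : Fin n, ∑ j : Fin n,
      if i < j then
        ∑ α : Fin 3, ∑ β : Fin 3,
          (siteOp n (i, false) (pauli α) * siteOp n (j, false) (pauli β) -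
            siteOp n (i, true) (pauli α) * siteOp n (j, true) (pauli β)) ^ 2
      else 0

/-- Applying `siteOp n q M` to a column only changes the coordinate `q`. -/
theorem sum_siteOp_mul (n : ℕ) (q : Fin n × Bool) (M : Matrix (Fin 2) (Fin 2) ℂ)
    (x : (Fin n × Bool) → Fin 2) (f : ((Fin n × Bool) → Fin 2) → ℂ) :
    ∑ z, siteOp n q M x z * f z = ∑ a, M (x q) a * f (Function.update x q a) := by
  symm
  refine Finset.sum_of_injOn (fun a => Function.update x q a)
    (Function.update_injective x q).injOn (by simp) ?_ ?_
  · intro z _ hz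
    have hne : ¬ ∀ p : Fin n × Bool, p ≠ q → x p = z p := by
      intro h
      refine hz ⟨z q, by simp, ?_⟩
      funext p
      by_cases hp : p = q
      · subst hp
        simp
      · simp [hp, h p hp]
    simp only [siteOp, Matrix.of_apply, if_neg hne, zero_mul]
  · intro a _
    have heq : ∀ p : Fin n × Bool, p ≠ q → x p = Function.update x q a p := by
      intro p hp
      simp [hp]
    simp only [siteOp, Matrix.of_apply]
    rw [if_pos heq]
    simp

theorem siteOp_one (n : ℕ) (q : Fin n × Bool) : siteOp n q 1 = 1 := by
  ext x y
  by_cases hxy : x = y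
  · subst hxy
    simp [siteOp]
  · rw [Matrix.one_apply_ne hxy]
    by_cases hq : x q = y q
    · have hne : ¬ ∀ p : Fin n × Bool, p ≠ q → x p = y p := by
        intro h
        refine hxy (funext fun p => ?_)
        by_cases hp : p = q
        · rw [hp, hq]
        · exact h p hp
      simp only [siteOp, Matrix.of_apply, if_neg hne, zero_mul]
    · simp [siteOp, Matrix.one_apply_ne hq]

theorem siteOp_mul_siteOp_same (n : ℕ) (q : Fin n × Bool) (M N : Matrix (Fin 2) (Fin 2) ℂ) :
    siteOp n q M * siteOp n q N = siteOp n q (M * N) := by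
  ext x y
  rw [Matrix.mul_apply, sum_siteOp_mul]
  have hiff (a : Fin 2) : (∀ p : Fin n × Bool, p ≠ q → Function.update x q a p = y p) ↔
      ∀ p : Fin n × Bool, p ≠ q → x p = y p :=
    forall₂_congr fun p hp => by rw [Function.update_of_ne hp]
  simp only [siteOp, Matrix.of_apply, hiff, Function.update_self, Matrix.mul_apply,
    Finset.mul_sum]
  exact Finset.sum_congr rfl fun a _ => by ring

theorem siteOp_mul_siteOp_apply_of_ne (n : ℕ) {q p : Fin n × Bool} (hqp : q ≠ p)
    (M N : Matrix (Fin 2) (Fin 2) ℂ) (x y : (Fin n × Bool) → Fin 2) :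
    (siteOp n q M * siteOp n p N) x y =
      (if ∀ r : Fin n × Bool, r ≠ q → r ≠ p → x r = y r then (1 : ℂ) else 0) *
        (M (x q) (y q) * N (x p) (y p)) := by
  rw [Matrix.mul_apply, sum_siteOp_mul]
  have hiff (a : Fin 2) : (∀ r : Fin n × Bool, r ≠ p → Function.update x q a r = y r) ↔
      a = y q ∧ ∀ r : Fin n × Bool, r ≠ q → r ≠ p → x r = y r := by
    constructor
    · intro h
      refine ⟨by simpa using h q hqp, fun r hr hrp => ?_⟩
      simpa [hr] using h r hrp
    · rintro ⟨rfl, h⟩ r hrp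
      by_cases hr : r = q
      · subst hr
        simp
      · simpa [hr] using h r hr hrp
  simp only [siteOp, Matrix.of_apply, hiff, Function.update_of_ne hqp.symm]
  rw [Finset.sum_eq_single (y q)]
  · simp only [true_and]
    ring
  · intro a _ ha
    simp [ha]
  · simp

theorem siteOp_commute (n : ℕ) {q p : Fin n × Bool} (hqp : q ≠ p)
    (M N : Matrix (Fin 2) (Fin 2) ℂ) : Commute (siteOp n q M) (siteOp n p N) := by
  ext x y
  rw [siteOp_mul_siteOp_apply_of_ne n hqp, siteOp_mul_siteOp_apply_of_ne n hqp.symm,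
    mul_comm (M _ _)]
  congr 2
  exact propext (forall_congr' fun r => forall_comm)

theorem pauli_mul_self (α : Fin 3) : pauli α * pauli α = 1 := by
  fin_cases α <;> simp [pauli, Matrix.one_fin_two]

theorem siteOp_pauli_mul_self (n : ℕ) (q : Fin n × Bool) (α : Fin 3) :
    siteOp n q (pauli α) * siteOp n q (pauli α) = 1 := by
  rw [siteOp_mul_siteOp_same, pauli_mul_self, siteOp_one]

theorem heis_commute (n : ℕ) {i j : Fin n} (hij : i ≠ j) : Commute (heis n i) (heis n j) := by
  have hne (a b : Bool) : (i, a) ≠ (j, b) := fun h => hij (congrArg Prod.fst h)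
  refine Commute.sum_left _ _ _ fun α _ => Commute.sum_right _ _ _ fun β _ => ?_
  exact ((siteOp_commute n (hne _ _) _ _).mul_right (siteOp_commute n (hne _ _) _ _)).mul_left
    ((siteOp_commute n (hne _ _) _ _).mul_right (siteOp_commute n (hne _ _) _ _))

/-- For commuting involutions, `(ab - cd)² = 2 - 2(ac)(bd)`. -/
theorem sq_mul_sub_mul_of_involutions {R : Type*} [Ring R] {a b c d : R}
    (ha : a * a = 1) (hb : b * b = 1) (hc : c * c = 1) (hd : d * d = 1)
    (hab : Commute a b) (hac : Commute a c) (had : Commute a d) (hbc : Commute b c)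
    (hbd : Commute b d) (hcd : Commute c d) :
    (a * b - c * d) ^ 2 = 2 - 2 * (a * c * (b * d)) := by
  have hsq₁ : (a * b) ^ 2 = 1 := by rw [hab.mul_pow, sq, sq, ha, hb, one_mul]
  have hsq₂ : (c * d) ^ 2 = 1 := by rw [hcd.mul_pow, sq, sq, hc, hd, one_mul]
  have hcomm : Commute (a * b) (c * d) := (hac.mul_right had).mul_left (hbc.mul_right hbd)
  have hmid : a * b * (c * d) = a * c * (b * d) := hbc.mul_mul_mul_comm a d
  rw [sq] at hsq₁ hsq₂
  rw [sq, sub_mul, mul_sub, mul_sub, hsq₁, hsq₂, ← hcomm.eq, hmid, two_mul, ← one_add_one_eq_two]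
  abel

theorem sum_sq_pauli_pair_sub (n : ℕ) {i j : Fin n} (hij : i ≠ j) :
    ∑ α : Fin 3, ∑ β : Fin 3,
      (siteOp n (i, false) (pauli α) * siteOp n (j, false) (pauli β) -
        siteOp n (i, true) (pauli α) * siteOp n (j, true) (pauli β)) ^ 2 =
      18 - 2 * (heis n i * heis n j) := by
  have hne (a b : Bool) : (i, a) ≠ (j, b) := fun h => hij (congrArg Prod.fst h)
  have hterm (α β : Fin 3) :
      (siteOp n (i, false) (pauli α) * siteOp n (j, false) (pauli β) -
        siteOp n (i, true) (pauli α) * siteOp n (j, true) (pauli β)) ^ 2 =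
      2 - 2 * (siteOp n (i, false) (pauli α) * siteOp n (i, true) (pauli α) *
        (siteOp n (j, false) (pauli β) * siteOp n (j, true) (pauli β))) :=
    sq_mul_sub_mul_of_involutions (siteOp_pauli_mul_self _ _ _) (siteOp_pauli_mul_self _ _ _)
      (siteOp_pauli_mul_self _ _ _) (siteOp_pauli_mul_self _ _ _)
      (siteOp_commute n (hne _ _) _ _) (siteOp_commute n (by simp) _ _)
      (siteOp_commute n (hne _ _) _ _) (siteOp_commute n (hne _ _).symm _ _)
      (siteOp_commute n (by simp) _ _) (siteOp_commute n (hne _ _) _ _)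
  simp only [hterm, Finset.sum_sub_distrib, ← Finset.mul_sum, ← Finset.sum_mul, heis]
  congr 1
  simp only [Finset.sum_const, Finset.card_univ, Fintype.card_fin, nsmul_eq_mul]
  norm_num

theorem two_nsmul_sum_lt_of_symmetric {ι A : Type*} [Fintype ι] [LinearOrder ι] [AddCommGroup A]
    (f : ι → ι → A) (hf : ∀ i j, f i j = f j i) :
    2 • ∑ i, ∑ j, (if i < j then f i j else 0) = ∑ i, ∑ j, f i j - ∑ i, f i i := by
  have hswap : ∑ i, ∑ j, (if i < j then f i j else 0) =
      ∑ i, ∑ j, (if j < i then f i j else 0) := by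
    rw [Finset.sum_comm]
    simp only [hf]
  have hdiag : ∑ i, f i i = ∑ i, ∑ j, (if i = j then f i j else 0) := by simp
  rw [two_nsmul, eq_sub_iff_add_eq, hdiag]
  nth_rewrite 2 [hswap]
  simp only [← Finset.sum_add_distrib]
  refine Finset.sum_congr rfl fun i _ => Finset.sum_congr rfl fun j _ => ?_
  rcases lt_trichotomy i j with h | h | h
  · simp [h, h.not_gt, h.ne]
  · simp [h]
  · simp [h, h.not_gt, h.ne']

/-- the operator identity
`H_eff = −(J/(2n)) (∑_i σ⃗_{iL}·σ⃗_{iR})² + (9J/2)(n−1)·Id + (J/(2n)) ∑_i (σ⃗_{iL}·σ⃗_{iR})²`. -/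
theorem Heff_heisenberg_form (n : ℕ) (hn : 1 ≤ n) (J : ℝ) (hJ : 0 < J) :
    Heff n J =
      (-(J / (2 * n)) : ℂ) • (∑ i : Fin n, heis n i) ^ 2 +
      (((9 * J / 2) * ((n : ℝ) - 1) : ℝ) : ℂ) • (1 : Matrix _ _ ℂ) +
      ((J / (2 * n) : ℝ) : ℂ) • ∑ i : Fin n, (heis n i) ^ 2 := by
  have hn₀ : (n : ℂ) ≠ 0 := Nat.cast_ne_zero.mpr (by omega)
  have hsum := two_nsmul_sum_lt_of_symmetric (fun i j : Fin n => 18 - 2 * (heis n i * heis n j))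
    fun i j => by
      by_cases hij : i = j
      · rw [hij]
      · simp only [(heis_commute n hij).eq]
  have hHeff : Heff n J = ((J / (2 * n) : ℝ) : ℂ) •
      ∑ i : Fin n, ∑ j : Fin n, if i < j then 18 - 2 * (heis n i * heis n j) else 0 := by
    rw [Heff]
    congr 1
    refine Finset.sum_congr rfl fun i _ => Finset.sum_congr rfl fun j _ => ?_
    split_ifs with hij
    · exact sum_sq_pauli_pair_sub n hij.ne
    · rfl
  have hpairs : ∑ i : Fin n, ∑ j : Fin n,
      (if i < j then 18 - 2 * (heis n i * heis n j) else 0) =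
      (9 * n * (n - 1) : ℂ) • (1 : Matrix ((Fin n × Bool) → Fin 2) ((Fin n × Bool) → Fin 2) ℂ) -
        (∑ i : Fin n, heis n i) ^ 2 + ∑ i : Fin n, heis n i ^ 2 := by
    have h18 : (18 : Matrix ((Fin n × Bool) → Fin 2) ((Fin n × Bool) → Fin 2) ℂ) =
        (18 : ℂ) • 1 := by
      rw [← Algebra.algebraMap_eq_smul_one, map_ofNat]
    refine smul_right_injective _ (two_ne_zero (α := ℂ)) ?_
    rw [← Nat.cast_smul_eq_nsmul ℂ, Nat.cast_ofNat] at hsum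
    simp only [hsum]
    simp only [Finset.sum_sub_distrib, ← Finset.mul_sum, ← Finset.sum_mul, ← sq,
      Finset.sum_const, Finset.card_univ, Fintype.card_fin]
    simp only [h18, two_mul]
    module
  rw [hHeff, hpairs]
  push_cast
  match_scalars <;> field_simp
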